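/- arXiv:1010.0590 — 3 statements merged into one kernel-verified Lean document; each statement's English description precedes it below -/
import Mathlib

section
/- Let Y be a geodesic Polish metric space, let μ₀ ∈ W₂(Y) not be a Dirac mass, and let y ∈ supp μ₀. Then the geodesic segment (μ_t)_{t∈[0,1]} of W₂(Y) from μ₀ to μ₁ := δ_y cannot be extended to a geodesic on [0, 1+ε] for any ε > 0. -/
open MeasureTheory Filter Set Topology
open scoped NNReal ENNReal

noncomputable section


/-! ## Geodesics and Hadamard spaces -/

/-- `γ` is a geodesic on the set of parameters `s`, of speed `v`, with respect to the
distance function `d`. -/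
def IsGeodesicOnWith {A : Type*} (d : A → A → ℝ) (γ : ℝ → A) (s : Set ℝ) (v : ℝ) : Prop :=
  ∀ t ∈ s, ∀ t' ∈ s, d (γ t) (γ t') = v * |t - t'|

/-- A metric space is geodesic if any two points are joined by a geodesic. -/
def IsGeodesicSpace (Y : Type*) [MetricSpace Y] : Prop :=
  ∀ x y : Y, ∃ γ : ℝ → Y, γ 0 = x ∧ γ 1 = y ∧
    IsGeodesicOnWith dist γ (Set.Icc (0:ℝ) 1) (dist x y)

/-- Every geodesic segment extends to a complete geodesic (defined on all of `ℝ`). -/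
def GeodesicallyComplete (Y : Type*) [MetricSpace Y] : Prop :=
  ∀ (γ : ℝ → Y) (a b v : ℝ), a < b → IsGeodesicOnWith dist γ (Set.Icc a b) v →
    ∃ g : ℝ → Y, IsGeodesicOnWith dist g Set.univ v ∧ ∀ t ∈ Set.Icc a b, g t = γ t

/-- A Hadamard space: complete, separable, locally compact, geodesic, globally CAT(0).
The CAT(0) comparison inequality is expressed through the explicit formula for the distance
from a vertex to a point of the opposite side in the Euclidean comparison triangle. -/
structure IsHadamard (X : Type*) [MetricSpace X] : Prop where
  complete : CompleteSpace X
  separable : TopologicalSpace.SeparableSpace X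
  locallyCompact : LocallyCompactSpace X
  geodesic : IsGeodesicSpace X
  cat0 : ∀ (x y z : X) (γ : ℝ → X), γ 0 = y → γ 1 = z →
    IsGeodesicOnWith dist γ (Set.Icc (0:ℝ) 1) (dist y z) →
    ∀ t ∈ Set.Icc (0:ℝ) 1,
      dist x (γ t) ^ 2 ≤ (1 - t) * dist x y ^ 2 + t * dist x z ^ 2 - t * (1 - t) * dist y z ^ 2

/-- A space is non-branching if two geodesics coinciding on a nonempty open set of parameters
coincide on their whole common interval of definition. -/
def NonBranching (X : Type*) [MetricSpace X] : Prop :=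
  ∀ (γ β : ℝ → X) (I : Set ℝ) (v w : ℝ),
    IsGeodesicOnWith dist γ I v → IsGeodesicOnWith dist β I w →
    (∃ U : Set ℝ, U ⊆ I ∧ IsOpen U ∧ U.Nonempty ∧ ∀ t ∈ U, γ t = β t) →
    ∀ t ∈ I, γ t = β t

/-! ## The Wasserstein space -/

/-- `π` is a coupling (transport plan) between `μ` and `ν`. -/
def IsCoupling {A B : Type*} [MeasurableSpace A] [MeasurableSpace B]
    (π : Measure (A × B)) (μ : Measure A) (ν : Measure B) : Prop :=
  π.map Prod.fst = μ ∧ π.map Prod.snd = ν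

/-- The quadratic Wasserstein space over `Y`: Borel probability measures with finite second
moment. -/
abbrev W2Space (Y : Type*) [MetricSpace Y] [MeasurableSpace Y] : Type _ :=
  {μ : Measure Y // IsProbabilityMeasure μ ∧
    ∃ x₀ : Y, (∫⁻ x, ENNReal.ofReal (dist x₀ x) ^ 2 ∂μ) < ⊤}

/-- The quadratic transport cost between two measures. -/
def W2cost {Y : Type*} [MetricSpace Y] [MeasurableSpace Y] (μ ν : Measure Y) : ℝ≥0∞ :=
  ⨅ (π : Measure (Y × Y)) (_ : IsCoupling π μ ν),
    ∫⁻ p, ENNReal.ofReal (dist p.1 p.2) ^ 2 ∂π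

/-- The quadratic Wasserstein distance. -/
def Wdist {Y : Type*} [MetricSpace Y] [MeasurableSpace Y] (μ ν : W2Space Y) : ℝ :=
  Real.sqrt (W2cost μ.1 ν.1).toReal


/-! ## Rays, complete geodesics, the boundary at infinity and the cone over it -/

/-- Geodesic rays of `X` (arbitrary nonnegative speed), parametrized by `ℝ≥0`.
The topology (of a subtype of a product) coincides on this set with the topology of
uniform convergence on compact sets. -/
abbrev RaySpace (X : Type*) [MetricSpace X] : Type _ :=
  {γ : ℝ≥0 → X // ∃ v : ℝ, 0 ≤ v ∧ ∀ s t : ℝ≥0, dist (γ s) (γ t) = v * dist s t}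

/-- Unit speed geodesic rays of `X`. -/
abbrev UnitRay (X : Type*) [MetricSpace X] : Type _ :=
  {γ : ℝ≥0 → X // ∀ s t : ℝ≥0, dist (γ s) (γ t) = dist s t}

/-- Complete geodesics of `X` (arbitrary nonnegative speed). -/
abbrev GeoLine (X : Type*) [MetricSpace X] : Type _ :=
  {γ : ℝ → X // ∃ v : ℝ, 0 ≤ v ∧ ∀ s t : ℝ, dist (γ s) (γ t) = v * |s - t|}

/-- Complete unit speed geodesics of `X`. -/
abbrev UnitLine (X : Type*) [MetricSpace X] : Type _ :=
  {γ : ℝ → X // ∀ s t : ℝ, dist (γ s) (γ t) = |s - t|}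

/-- Evaluation of a ray at time `t`. -/
def rayEval {X : Type*} [MetricSpace X] (t : ℝ≥0) : RaySpace X → X := fun γ => γ.1 t

/-- Two curves (w.r.t. a distance function `d`) are asymptotic if they stay at bounded
distance. -/
def AsymptoticMaps {A : Type*} (d : A → A → ℝ) (γ β : ℝ≥0 → A) : Prop :=
  ∃ C : ℝ, ∀ t, d (γ t) (β t) ≤ C

/-- The asymptote relation on unit-speed rays. -/
def unitRaySetoid (X : Type*) [MetricSpace X] : Setoid (UnitRay X) where
  r γ β := AsymptoticMaps dist γ.1 β.1
  iseqv := by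
    refine ⟨fun γ => ⟨0, fun t => by simp⟩, ?_, ?_⟩
    · rintro γ β ⟨C, h⟩
      exact ⟨C, fun t => by rw [dist_comm]; exact h t⟩
    · rintro γ β δ ⟨C, h⟩ ⟨C', h'⟩
      exact ⟨C + C', fun t => (dist_triangle _ _ _).trans (add_le_add (h t) (h' t))⟩

/-- The geodesic boundary of `X`: asymptote classes of unit-speed rays, with the quotient
topology of the topology of uniform convergence on compact sets (the cone topology). -/
abbrev Boundary (X : Type*) [MetricSpace X] := Quotient (unitRaySetoid X)

/-- Apex-like points, to be collapsed when forming the cone over `B`. -/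
def coneIsApex {B : Type*} : B × ℝ≥0 ⊕ Unit → Prop
  | Sum.inl p => p.2 = 0
  | Sum.inr _ => True

/-- The relation collapsing all apex-like points. -/
def coneSetoid (B : Type*) : Setoid (B × ℝ≥0 ⊕ Unit) where
  r p q := p = q ∨ (coneIsApex p ∧ coneIsApex q)
  iseqv := by
    refine ⟨fun p => Or.inl rfl, ?_, ?_⟩
    · rintro p q (rfl | h)
      · exact Or.inl rfl
      · exact Or.inr ⟨h.2, h.1⟩
    · rintro p q r (rfl | h) (rfl | h')
      · exact Or.inl rfl
      · exact Or.inr h'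
      · exact Or.inr h
      · exact Or.inr ⟨h.1, h'.2⟩

/-- The cone over a space `B`: the quotient of `B × [0,∞)` collapsing the zero level to the
apex, with the quotient topology. -/
abbrev Cone (B : Type*) := Quotient (coneSetoid B)

/-- The point of the cone over `b` at height (speed) `s`. -/
def coneMk {B : Type*} (b : B) (s : ℝ≥0) : Cone B :=
  Quotient.mk (coneSetoid B) (Sum.inl (b, s))

/-- The apex of the cone. -/
def conePt (B : Type*) : Cone B := Quotient.mk (coneSetoid B) (Sum.inr ())

private def coneSpeedAux {B : Type*} : B × ℝ≥0 ⊕ Unit → ℝ≥0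
  | Sum.inl p => p.2
  | Sum.inr _ => 0

/-- The speed (radial) coordinate of a point of the cone. -/
def coneSpeed {B : Type*} : Cone B → ℝ≥0 :=
  Quotient.lift coneSpeedAux (by
    rintro p q (rfl | ⟨h1, h2⟩)
    · rfl
    · cases p <;> cases q <;> simp_all [coneIsApex, coneSpeedAux])

/-- The speed of a geodesic ray. -/
def raySpeed {X : Type*} [MetricSpace X] (γ : RaySpace X) : ℝ≥0 :=
  nndist (γ.1 0) (γ.1 1)

lemma raySpeed_eq {X : Type*} [MetricSpace X] (γ : RaySpace X) {v : ℝ} (hv0 : 0 ≤ v)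
    (hv : ∀ s t : ℝ≥0, dist (γ.1 s) (γ.1 t) = v * dist s t) : (raySpeed γ : ℝ) = v := by
  have h1 := hv 0 1
  have h2 : dist (0 : ℝ≥0) (1 : ℝ≥0) = 1 := by rw [NNReal.dist_eq]; norm_num
  rw [h2, mul_one] at h1
  rw [show (raySpeed γ : ℝ) = dist (γ.1 0) (γ.1 1) from (dist_nndist _ _).symm, h1]

/-- The unit reparametrization of a nonconstant ray. -/
def rayUnit {X : Type*} [MetricSpace X] (γ : RaySpace X) (h : raySpeed γ ≠ 0) : UnitRay X := by
  refine ⟨fun t => γ.1 (t / raySpeed γ), ?_⟩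
  obtain ⟨v, hv0, hv⟩ := γ.2
  have hveq : (raySpeed γ : ℝ) = v := raySpeed_eq γ hv0 hv
  intro s t
  have hr : (raySpeed γ : ℝ) ≠ 0 := by
    simpa using h
  show dist (γ.1 (s / raySpeed γ)) (γ.1 (t / raySpeed γ)) = dist s t
  rw [hv, NNReal.dist_eq, NNReal.dist_eq, NNReal.coe_div, NNReal.coe_div,
    div_sub_div_same, abs_div, abs_of_nonneg (raySpeed γ).coe_nonneg, ← hveq]
  field_simp

/-- The point at infinity (in the cone over the boundary) defined by a geodesic ray:
its asymptote class together with its speed; constant rays are sent to the apex. -/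
def rayEnd {X : Type*} [MetricSpace X] (γ : RaySpace X) : Cone (Boundary X) :=
  if h : raySpeed γ = 0 then conePt (Boundary X)
  else coneMk (Quotient.mk (unitRaySetoid X) (rayUnit γ h)) (raySpeed γ)

/-! ## Asymptotic distance -/

def dInfty {X : Type*} [MetricSpace X] (γ β : ℝ≥0 → X) : ℝ :=
  Filter.limsup (fun t : ℝ≥0 => dist (γ t) (β t) / (t : ℝ)) Filter.atTop

/-- The asymptotic (angular) distance on the boundary, computed on representative rays
(it does not depend on the choice of representatives). -/
def boundaryDist {X : Type*} [MetricSpace X] (ξ ζ : Boundary X) : ℝ :=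
  dInfty (ξ.out).1 (ζ.out).1

def coneDistAux {X : Type*} [MetricSpace X] :
    Boundary X × ℝ≥0 ⊕ Unit → Boundary X × ℝ≥0 ⊕ Unit → ℝ
  | Sum.inl p, Sum.inl q =>
      Real.sqrt (((p.2 : ℝ) - (q.2 : ℝ)) ^ 2 + (p.2 : ℝ) * (q.2 : ℝ) * boundaryDist p.1 q.1 ^ 2)
  | Sum.inl p, Sum.inr _ => p.2
  | Sum.inr _, Sum.inl q => q.2
  | Sum.inr _, Sum.inr _ => 0

/-- The asymptotic distance on the cone over the boundary (the cone metric). -/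
def coneDist {X : Type*} [MetricSpace X] : Cone (Boundary X) → Cone (Boundary X) → ℝ :=
  Quotient.lift₂ coneDistAux (by
    rintro a₁ a₂ b₁ b₂ h12 h34
    rcases h12 with rfl | ⟨h1, h2⟩ <;> rcases h34 with rfl | ⟨h3, h4⟩
    · rfl
    · rcases a₁ with p | u <;> rcases a₂ with q | v <;> rcases b₂ with q' | w <;>
        simp_all [coneIsApex, coneDistAux, Real.sqrt_sq, NNReal.coe_nonneg]
    · rcases a₂ with q | u <;> rcases a₁ with p | v <;> rcases b₁ with p' | w <;>
        simp_all [coneIsApex, coneDistAux, Real.sqrt_sq, NNReal.coe_nonneg]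
    · rcases a₁ with p | u <;> rcases a₂ with q | v <;> rcases b₁ with p' | w <;>
        rcases b₂ with q' | w' <;>
        simp_all [coneIsApex, coneDistAux, Real.sqrt_sq, NNReal.coe_nonneg])


-- Borel measurable structure on the boundary and the cone over it.
instance (X : Type*) [MetricSpace X] : MeasurableSpace (Boundary X) := borel _
instance (X : Type*) [MetricSpace X] : BorelSpace (Boundary X) := ⟨rfl⟩
instance (X : Type*) [MetricSpace X] : MeasurableSpace (Cone (Boundary X)) := borel _
instance (X : Type*) [MetricSpace X] : BorelSpace (Cone (Boundary X)) := ⟨rfl⟩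

/-- The Wasserstein metric `W_∞` on measures on the cone over the boundary, built from the
cost `d_∞²`. -/
def Winfty {X : Type*} [MetricSpace X] (m m' : Measure (Cone (Boundary X))) : ℝ :=
  Real.sqrt (⨅ (π : Measure (Cone (Boundary X) × Cone (Boundary X)))
    (_ : IsCoupling π m m'),
      ∫⁻ p, ENNReal.ofReal (coneDist p.1 p.2) ^ 2 ∂π).toReal


/-! ## Visibility -/

/-- `X` is a visibility space: any two distinct boundary points are the two endpoints of a
complete geodesic. -/
def IsVisibility (X : Type*) [MetricSpace X] : Prop :=
  ∀ α ω : UnitRay X, ¬ AsymptoticMaps dist α.1 ω.1 →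
    ∃ g : ℝ → X, (∀ s t : ℝ, dist (g s) (g t) = |s - t|) ∧
      AsymptoticMaps dist (fun t : ℝ≥0 => g (-(t : ℝ))) α.1 ∧
      AsymptoticMaps dist (fun t : ℝ≥0 => g (t : ℝ)) ω.1

/-! ## Curves, length, rectifiability -/

/-- The length of a curve with respect to a distance function `d`, as a supremum over
finite monotone sequences of parameters in `[a,b]`. -/
def curveLengthWith {A : Type*} (d : A → A → ℝ) (c : ℝ → A) (a b : ℝ) : ℝ≥0∞ :=
  ⨆ (n : ℕ) (t : Fin (n + 1) → ℝ) (_ : Monotone t) (_ : ∀ i, t i ∈ Set.Icc a b),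
    ∑ i : Fin n, ENNReal.ofReal (d (c (t i.castSucc)) (c (t i.succ)))

/-- Continuity of a curve with respect to a distance function `d`, on a set of parameters. -/
def ContinuousWithRespect {A : Type*} (d : A → A → ℝ) (c : ℝ → A) (s : Set ℝ) : Prop :=
  ∀ t ∈ s, ∀ ε : ℝ, 0 < ε → ∃ δ : ℝ, 0 < δ ∧ ∀ u ∈ s, |u - t| < δ → d (c u) (c t) < ε

/-- `W_∞` between measures on the boundary, viewed as the level `{speed = 1}` of the cone,
with cost `d_∞²`. -/
def WinftyLevel1 {X : Type*} [MetricSpace X] (m m' : Measure (Boundary X)) : ℝ :=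
  Real.sqrt (⨅ (π : Measure (Boundary X × Boundary X)) (_ : IsCoupling π m m'),
    ∫⁻ p, ENNReal.ofReal (coneDist (coneMk p.1 1) (coneMk p.2 1)) ^ 2 ∂π).toReal

/-! ## Support of a measure -/

/-- The (topological) support of a measure. -/
def msupport {A : Type*} [TopologicalSpace A] [MeasurableSpace A] (μ : Measure A) : Set A :=
  {x | ∀ U : Set A, x ∈ U → IsOpen U → 0 < μ U}

/-! ## Cyclical monotonicity and antagonism -/

/-- A set `Γ` is `c`-cyclically monotone if no cyclic permutation of the target points of a
finite family of pairs of `Γ` decreases the total cost. -/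
def CyclicallyMonotone {A : Type*} (c : A → A → ℝ) (Γ : Set (A × A)) : Prop :=
  ∀ (m : ℕ) (p : Fin (m + 1) → A × A), (∀ i, p i ∈ Γ) →
    (∑ i, c (p i).1 (p i).2) ≤ ∑ i, c (p i).1 (p (i + 1)).2

/-- Two curves are antagonist if they pass through two distinct points in opposite orders. -/
def Antagonist {X : Type*} (γ β : ℝ → X) : Prop :=
  ∃ x y : X, x ≠ y ∧ (∃ s t : ℝ, s < t ∧ γ s = x ∧ γ t = y) ∧
    (∃ s t : ℝ, s < t ∧ β s = y ∧ β t = x)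

/-! ## Negative curvature, trees -/

/-- Three points lying on a common geodesic. -/
def Aligned {X : Type*} [MetricSpace X] (x y z : X) : Prop :=
  dist x y + dist y z = dist x z ∨ dist y x + dist x z = dist y z ∨
    dist x z + dist z y = dist x y

/-- `X` is negatively curved: it is not a line, and the CAT(0) comparison inequality is
strict except for aligned triangles. -/
def IsNegativelyCurved (X : Type*) [MetricSpace X] : Prop :=
  (¬ ∃ f : ℝ → X, Function.Surjective f ∧ ∀ s t : ℝ, dist (f s) (f t) = |s - t|) ∧
  ∀ (x y z : X) (γ : ℝ → X), γ 0 = y → γ 1 = z →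
    IsGeodesicOnWith dist γ (Set.Icc (0:ℝ) 1) (dist y z) → ¬ Aligned x y z →
    ∀ t ∈ Set.Ioo (0:ℝ) 1,
      dist x (γ t) ^ 2 < (1 - t) * dist x y ^ 2 + t * dist x z ^ 2 - t * (1 - t) * dist y z ^ 2

/-- A metric tree (real tree): a geodesic space satisfying the four-point 0-hyperbolicity
condition. -/
def IsRealTree (X : Type*) [MetricSpace X] : Prop :=
  IsGeodesicSpace X ∧ ∀ x y z w : X,
    dist x y + dist z w ≤ max (dist x z + dist y w) (dist x w + dist y z)

/-! ## Ends of complete geodesics -/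

/-- The forward ray of a complete geodesic. -/
def lineForward {X : Type*} [MetricSpace X] (γ : GeoLine X) : RaySpace X :=
  ⟨fun t : ℝ≥0 => γ.1 (t : ℝ), by
    obtain ⟨v, hv0, hv⟩ := γ.2
    exact ⟨v, hv0, fun s t => by rw [hv, NNReal.dist_eq]⟩⟩

/-- The backward ray of a complete geodesic. -/
def lineBackward {X : Type*} [MetricSpace X] (γ : GeoLine X) : RaySpace X :=
  ⟨fun t : ℝ≥0 => γ.1 (-(t : ℝ)), by
    obtain ⟨v, hv0, hv⟩ := γ.2
    refine ⟨v, hv0, fun s t => ?_⟩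
    rw [hv, NNReal.dist_eq]
    congr 1
    rw [abs_sub_comm]
    congr 1
    ring⟩

/-- The end at `+∞` of a complete geodesic, in the cone over the boundary. -/
def lineEndPlus {X : Type*} [MetricSpace X] (γ : GeoLine X) : Cone (Boundary X) :=
  rayEnd (lineForward γ)

/-- The end at `-∞` of a complete geodesic, in the cone over the boundary. -/
def lineEndMinus {X : Type*} [MetricSpace X] (γ : GeoLine X) : Cone (Boundary X) :=
  rayEnd (lineBackward γ)

/-- `g` is a unit complete geodesic with ends `ξ` (at `-∞`) and `ζ` (at `+∞`). -/
def LineConnects {X : Type*} [MetricSpace X] (g : ℝ → X) (ξ ζ : Boundary X) : Prop :=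
  (∀ s t : ℝ, dist (g s) (g t) = |s - t|) ∧
  (∃ γ : UnitRay X, Quotient.mk (unitRaySetoid X) γ = ξ ∧
    AsymptoticMaps dist (fun u : ℝ≥0 => g (-(u : ℝ))) γ.1) ∧
  (∃ γ : UnitRay X, Quotient.mk (unitRaySetoid X) γ = ζ ∧
    AsymptoticMaps dist (fun u : ℝ≥0 => g (u : ℝ)) γ.1)

/-- Two boundary points are antipodal if they are joined by a complete geodesic. -/
def Antipodal {X : Type*} [MetricSpace X] (ξ ζ : Boundary X) : Prop :=
  ∃ g : ℝ → X, LineConnects g ξ ζ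

/-- Two measures on the boundary are antipodal if they are concentrated on antipodal sets. -/
def AntipodalMeasures {X : Type*} [MetricSpace X] (νm νp : Measure (Boundary X)) : Prop :=
  ∃ A B : Set (Boundary X), MeasurableSet A ∧ MeasurableSet B ∧ νm A = 1 ∧ νp B = 1 ∧
    ∀ ξ ∈ A, ∀ ζ ∈ B, Antipodal ξ ζ

/-- Two measures on the boundary are uniformly antipodal if their supports are antipodal. -/
def UniformlyAntipodal {X : Type*} [MetricSpace X] (νm νp : Measure (Boundary X)) : Prop :=
  ∀ ξ ∈ msupport νm, ∀ ζ ∈ msupport νp, Antipodal ξ ζ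

/-- The distance from the base point `x₀` to the geodesic line joining two boundary points
(for trees, the Gromov product). -/
def D0 {X : Type*} [MetricSpace X] (x₀ : X) (ξ ζ : Boundary X) : ℝ :=
  sInf {r : ℝ | ∃ g : ℝ → X, LineConnects g ξ ζ ∧ ∃ t : ℝ, r = dist x₀ (g t)}

/-- The unit geodesic from `ξ` to `ζ`, parametrized so that its time-`0` point is closest to
the base point `x₀`. -/
def lineFrom {X : Type*} [MetricSpace X] (x₀ : X) (ξ ζ : Boundary X) : ℝ → X :=
  haveI : Nonempty X := ⟨x₀⟩
  Classical.epsilon fun g : ℝ → X =>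
    LineConnects g ξ ζ ∧ dist x₀ (g 0) = D0 x₀ ξ ζ

/-! ## Flows on trees -/

/-- The set of boundary points whose rays eventually lie in `C`. -/
def compBdry {X : Type*} [MetricSpace X] (C : Set X) : Set (Boundary X) :=
  {ξ | ∀ γ : UnitRay X, Quotient.mk (unitRaySetoid X) γ = ξ →
    ∃ T : ℝ≥0, ∀ t : ℝ≥0, T ≤ t → γ.1 t ∈ C}

/-- The connected components of the complement of a point. -/
def treeComps {X : Type*} [TopologicalSpace X] (x : X) : Set (Set X) :=
  {C | ∃ y : X, y ≠ x ∧ C = connectedComponentIn {x}ᶜ y}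

/-- A vertex (branch point) of a tree: the complement has at least three components. -/
def IsTreeVertex {X : Type*} [TopologicalSpace X] (x : X) : Prop :=
  ∃ C₁ C₂ C₃ : Set X, C₁ ∈ treeComps x ∧ C₂ ∈ treeComps x ∧ C₃ ∈ treeComps x ∧
    C₁ ≠ C₂ ∧ C₂ ≠ C₃ ∧ C₁ ≠ C₃

/-- The value of the signed measure `ν₊ - ν₋` on a set of boundary points. -/
def sflow {X : Type*} [MetricSpace X] (νm νp : Measure (Boundary X))
    (S : Set (Boundary X)) : ℝ :=
  (νp S).toReal - (νm S).toReal

/-- The boundary directions at `x` carrying positive flow. -/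
def posBdrySet {X : Type*} [MetricSpace X] (νm νp : Measure (Boundary X)) (x : X) :
    Set (Boundary X) :=
  ⋃ (C : Set X) (_ : C ∈ treeComps x) (_ : 0 < sflow νm νp (compBdry C)), compBdry C

/-- The boundary directions at `x` carrying negative flow. -/
def negBdrySet {X : Type*} [MetricSpace X] (νm νp : Measure (Boundary X)) (x : X) :
    Set (Boundary X) :=
  ⋃ (C : Set X) (_ : C ∈ treeComps x) (_ : sflow νm νp (compBdry C) < 0), compBdry C

/-- The flow through the point `x`. -/
def flowAt {X : Type*} [MetricSpace X] (νm νp : Measure (Boundary X)) (x : X) : ℝ :=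
  sflow νm νp (posBdrySet νm νp x)

open Classical in
/-- The specific flow through `x`: the flow through `x`, not counting the edge pointing
towards the base point `x₀` when the latter is positive (resp. negative). -/
def specificFlow {X : Type*} [MetricSpace X] (νm νp : Measure (Boundary X))
    (x₀ x : X) : ℝ :=
  if x = x₀ then flowAt νm νp x
  else if 0 < sflow νm νp (compBdry (connectedComponentIn {x}ᶜ x₀)) then
    sflow νm νp (posBdrySet νm νp x \ compBdry (connectedComponentIn {x}ᶜ x₀))
  else if sflow νm νp (compBdry (connectedComponentIn {x}ᶜ x₀)) < 0 then
    - sflow νm νp (negBdrySet νm νp x \ compBdry (connectedComponentIn {x}ᶜ x₀))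
  else flowAt νm νp x

/-- The pair `(ν₋, ν₊)` is realized as the pair of ends of a complete unit-speed geodesic of
the Wasserstein space, through a displacement interpolation `m`. -/
def RealizableEnds {X : Type*} [MetricSpace X] [MeasurableSpace X]
    (νm νp : Measure (Boundary X)) : Prop :=
  ∃ (μt : ℝ → W2Space X) (m : Measure (GeoLine X)), IsProbabilityMeasure m ∧
    (∀ s t : ℝ, Wdist (μt s) (μt t) = |s - t|) ∧
    (∀ t : ℝ, m.map (fun γ : GeoLine X => γ.1 t) = (μt t).1) ∧
    m.map lineEndMinus = νm.map (fun ξ : Boundary X => coneMk ξ 1) ∧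
    m.map lineEndPlus = νp.map (fun ξ : Boundary X => coneMk ξ 1)

/-- The cost `∫ D₀² dπ` of a transport plan (the optimal transport problem for the cost
`-D₀²` is finite iff the supremum of this quantity over all couplings is finite, and its
minimizers are the maximizers of this quantity). -/
def D0cost {X : Type*} [MetricSpace X] (x₀ : X)
    (π : Measure (Boundary X × Boundary X)) : ℝ≥0∞ :=
  ∫⁻ p, ENNReal.ofReal (D0 x₀ p.1 p.2) ^ 2 ∂π

/-- The supremum of `∫ D₀² dπ` over couplings of `(ν₋, ν₊)`. -/
def D0supCost {X : Type*} [MetricSpace X] (x₀ : X) (νm νp : Measure (Boundary X)) : ℝ≥0∞ :=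
  ⨆ (π : Measure (Boundary X × Boundary X)) (_ : IsCoupling π νm νp), D0cost x₀ π

/-! ## The geodesic boundary of the Wasserstein space -/

/-- The metric topology of the Wasserstein distance. -/
instance (Y : Type*) [MetricSpace Y] [MeasurableSpace Y] : TopologicalSpace (W2Space Y) :=
  TopologicalSpace.generateFrom
    {S | ∃ (μ : W2Space Y) (ε : ℝ), S = {ν : W2Space Y | Wdist μ ν < ε}}

/-- Unit-speed geodesic rays of the Wasserstein space. -/
abbrev W2UnitRay (X : Type*) [MetricSpace X] [MeasurableSpace X] : Type _ :=
  {f : ℝ≥0 → W2Space X // ∀ s t : ℝ≥0, Wdist (f s) (f t) = dist s t}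

/-- Probability measures on the cone over the boundary with `∫ v² dν = 1`, with the weak
topology. -/
abbrev P1Cone (X : Type*) [MetricSpace X] : Type _ :=
  {ν : ProbabilityMeasure (Cone (Boundary X)) //
    ∫⁻ c, (coneSpeed c : ℝ≥0∞) ^ 2 ∂(ν : Measure (Cone (Boundary X))) = 1}

/-- Probability measures (as plain measures) on the cone over the boundary with
`∫ v² dν = 1`. -/
abbrev P1ConeM (X : Type*) [MetricSpace X] : Type _ :=
  {ν : Measure (Cone (Boundary X)) // IsProbabilityMeasure ν ∧
    ∫⁻ c, (coneSpeed c : ℝ≥0∞) ^ 2 ∂ν = 1}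


/-! ## Locally Riemannian points -/

/-- The Riemannian length of a path `γ : [0,1] → ℝⁿ` for the metric tensor `g`. -/
def riemannianPathLength {n : ℕ}
    (g : EuclideanSpace ℝ (Fin n) → EuclideanSpace ℝ (Fin n) →L[ℝ] EuclideanSpace ℝ (Fin n))
    (γ : ℝ → EuclideanSpace ℝ (Fin n)) : ℝ :=
  ∫ t in (0:ℝ)..1, Real.sqrt (@inner ℝ _ _ (g (γ t) (deriv γ t)) (deriv γ t))

/-- The Riemannian distance in `U ⊆ ℝⁿ` for the metric tensor `g`: the infimum of
Riemannian lengths of `C¹` paths in `U` joining the two points. -/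
def riemannianDist {n : ℕ} (U : Set (EuclideanSpace ℝ (Fin n)))
    (g : EuclideanSpace ℝ (Fin n) → EuclideanSpace ℝ (Fin n) →L[ℝ] EuclideanSpace ℝ (Fin n))
    (p q : EuclideanSpace ℝ (Fin n)) : ℝ :=
  sInf {L : ℝ | ∃ γ : ℝ → EuclideanSpace ℝ (Fin n), ContDiffOn ℝ 1 γ (Set.Icc (0:ℝ) 1) ∧
    (∀ t ∈ Set.Icc (0:ℝ) 1, γ t ∈ U) ∧ γ 0 = p ∧ γ 1 = q ∧ L = riemannianPathLength g γ}

/-- `x` admits a neighborhood isometric to an open subset of a Riemannian manifold of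
dimension at least 2 (expressed in a chart: an open subset of `ℝⁿ`, `n ≥ 2`, equipped with
the distance induced by a smooth positive-definite symmetric metric tensor). -/
def IsLocallyRiemannian (X : Type*) [MetricSpace X] (x : X) : Prop :=
  ∃ n : ℕ, 2 ≤ n ∧
  ∃ (U : Set (EuclideanSpace ℝ (Fin n)))
    (g : EuclideanSpace ℝ (Fin n) → EuclideanSpace ℝ (Fin n) →L[ℝ] EuclideanSpace ℝ (Fin n))
    (V : Set X) (φ : X → EuclideanSpace ℝ (Fin n)),
    IsOpen U ∧ ContDiffOn ℝ (⊤ : ℕ∞) g U ∧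
    (∀ p ∈ U, ∀ v w : EuclideanSpace ℝ (Fin n),
      @inner ℝ _ _ (g p v) w = @inner ℝ _ _ v (g p w)) ∧
    (∀ p ∈ U, ∀ v : EuclideanSpace ℝ (Fin n), v ≠ 0 → 0 < @inner ℝ _ _ (g p v) v) ∧
    V ∈ nhds x ∧ Set.BijOn φ V U ∧
    ∀ a ∈ V, ∀ b ∈ V, dist a b = riemannianDist U g (φ a) (φ b)

/-! ## The combinatorial perpendicular Radon transform on a tree -/

/-- `y` and `z` lie in the same connected component of the graph `G` minus the vertex `x`. -/
def sameComp {V : Type*} (G : SimpleGraph V) (x y z : V) : Prop :=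
  ∃ (hy : y ≠ x) (hz : z ≠ x), (G.induce {w : V | w ≠ x}).Reachable ⟨y, hy⟩ ⟨z, hz⟩

/-- The perpendicular `⊥ˣ(ef)` of a flag: the union of `{x}` and of the components of
`G - x` containing none of the vertices of `p` (for a flag, `p = {e, f}` is a pair of
neighbors of `x`). -/
def perpSet {V : Type*} (G : SimpleGraph V) (x : V) (p : Finset V) : Set V :=
  {x} ∪ {y | ∀ e ∈ p, ¬ sameComp G x y e}

/-- The combinatorial perpendicular Radon transform of a summable function `h` on the
vertices, evaluated on a flag `(x, p)`. -/
def perpRadon {V : Type*} (G : SimpleGraph V) (h : V → ℝ) (x : V) (p : Finset V) : ℝ :=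
  ∑' y : perpSet G x p, h y


lemma isCoupling_prod {A B : Type*} [MeasurableSpace A] [MeasurableSpace B] (μ : Measure A)
    (ν : Measure B) [IsProbabilityMeasure μ] [IsProbabilityMeasure ν] :
    IsCoupling (μ.prod ν) μ ν := by
  constructor <;> simp

lemma Wdist_sq {Y : Type*} [MetricSpace Y] [MeasurableSpace Y] (a b : W2Space Y) :
    Wdist a b ^ 2 = (W2cost a.1 b.1).toReal :=
  Real.sq_sqrt ENNReal.toReal_nonneg

section Wasserstein

variable {Y : Type*} [MetricSpace Y] [MeasurableSpace Y] [BorelSpace Y]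
  [TopologicalSpace.SeparableSpace Y]

lemma W2Space.memLp_dist (a : W2Space Y) (y : Y) : MemLp (fun x => dist x y) 2 a.1 := by
  have := UniformSpace.secondCountable_of_separable Y
  obtain ⟨μ, hμ, x₀, hx₀⟩ := a
  have hmeas (z : Y) : AEStronglyMeasurable (fun x => dist x z) μ := by fun_prop
  have h₀ : MemLp (fun x => dist x x₀) 2 μ := by
    rw [memLp_two_iff_integrable_sq (hmeas x₀)]
    refine ⟨(hmeas x₀).pow 2, ?_⟩
    rw [hasFiniteIntegral_iff_ofReal (.of_forall fun x => sq_nonneg _)]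
    simpa only [ENNReal.ofReal_pow dist_nonneg, dist_comm x₀] using hx₀
  refine (h₀.add (memLp_const (dist x₀ y))).of_le (hmeas y) (.of_forall fun x => ?_)
  simp only [Pi.add_apply, Real.norm_eq_abs, abs_of_nonneg, dist_nonneg, add_nonneg]
  exact dist_triangle _ _ _

lemma W2Space.memLp_dist_add_dist (a b : W2Space Y) (y : Y) :
    MemLp (fun p : Y × Y => dist p.1 y + dist p.2 y) 2 (a.1.prod b.1) := by
  have := a.2.1
  have := b.2.1
  exact ((a.memLp_dist y).comp_fst b.1).add ((b.memLp_dist y).comp_snd a.1)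

lemma W2cost_le_integral (a b : W2Space Y) (y : Y) :
    W2cost a.1 b.1 ≤
      ENNReal.ofReal (∫ p, (dist p.1 y + dist p.2 y) ^ 2 ∂a.1.prod b.1) := by
  have := a.2.1
  have := b.2.1
  have hint := (a.memLp_dist_add_dist b y).integrable_sq
  rw [ofReal_integral_eq_lintegral_ofReal hint (.of_forall fun p => sq_nonneg _)]
  refine iInf₂_le_of_le (a.1.prod b.1) (isCoupling_prod a.1 b.1) (lintegral_mono fun p => ?_)
  rw [← ENNReal.ofReal_pow dist_nonneg]
  gcongr
  exact dist_triangle_right _ _ _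

lemma W2cost_ne_top (a b : W2Space Y) : W2cost a.1 b.1 ≠ ⊤ := by
  obtain ⟨y, -⟩ := a.2.2
  exact ne_top_of_le_ne_top ENNReal.ofReal_ne_top (W2cost_le_integral a b y)

lemma Wdist_sq_le (a b : W2Space Y) (y : Y) :
    Wdist a b ^ 2 ≤ ∫ x, dist x y ^ 2 ∂a.1 + ∫ x, dist x y ^ 2 ∂b.1
      + 2 * ((∫ x, dist x y ∂a.1) * ∫ x, dist x y ∂b.1) := by
  have := a.2.1
  have := b.2.1
  have ha := a.memLp_dist y
  have hb := b.memLp_dist y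
  have key : ∫ p, (dist p.1 y + dist p.2 y) ^ 2 ∂a.1.prod b.1 =
      ∫ x, dist x y ^ 2 ∂a.1 + ∫ x, dist x y ^ 2 ∂b.1
        + 2 * ((∫ x, dist x y ∂a.1) * ∫ x, dist x y ∂b.1) := by
    have i₁ := ha.integrable_sq.comp_fst b.1
    have i₂ := hb.integrable_sq.comp_snd a.1
    have i₁₂ : Integrable (fun p : Y × Y => dist p.1 y ^ 2 + dist p.2 y ^ 2) (a.1.prod b.1) :=
      i₁.add i₂
    have i₃ := ((ha.integrable one_le_two).mul_prod (hb.integrable one_le_two)).const_mul 2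
    calc ∫ p, (dist p.1 y + dist p.2 y) ^ 2 ∂a.1.prod b.1
        = ∫ p, (dist p.1 y ^ 2 + dist p.2 y ^ 2 + 2 * (dist p.1 y * dist p.2 y))
            ∂a.1.prod b.1 := by congr with p; ring
      _ = _ := by
        rw [integral_add i₁₂ i₃, integral_add i₁ i₂, integral_const_mul,
          integral_prod_mul (fun x => dist x y) (fun x => dist x y),
          integral_fun_fst (fun x => dist x y ^ 2), integral_fun_snd (fun x => dist x y ^ 2)]
        simp
  rw [Wdist_sq, ← key]
  exact ENNReal.toReal_le_of_le_ofReal (integral_nonneg fun p => sq_nonneg _)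
    (W2cost_le_integral a b y)

lemma integral_dist_sq_le_Wdist_sq (a b : W2Space Y) {y : Y} (hb : b.1 = Measure.dirac y) :
    ∫ x, dist x y ^ 2 ∂a.1 ≤ Wdist a b ^ 2 := by
  rw [Wdist_sq, ← ENNReal.ofReal_le_iff_le_toReal (W2cost_ne_top a b),
    ofReal_integral_eq_lintegral_ofReal (a.memLp_dist y).integrable_sq
      (.of_forall fun x => sq_nonneg _)]
  refine le_iInf₂ fun π hπ => ?_
  have hae : ∀ᵐ p ∂π, p.2 = y := by
    have : ∀ᵐ z ∂(π.map Prod.snd), z = y := by rw [hπ.2, hb, ae_dirac_eq]; rfl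
    exact ae_of_ae_map measurable_snd.aemeasurable this
  rw [← hπ.1, lintegral_map (by fun_prop) measurable_fst]
  refine (lintegral_congr_ae ?_).le
  filter_upwards [hae] with p hp
  rw [hp, ENNReal.ofReal_pow dist_nonneg]

end Wasserstein

lemma measure_eq_dirac_of_ae_eq {A : Type*} [MeasurableSpace A] {μ : Measure A}
    [IsProbabilityMeasure μ] {y : A} (h : ∀ᵐ x ∂μ, x = y) : μ = Measure.dirac y := by
  calc μ = μ.map id := Measure.map_id.symm
    _ = μ.map (fun _ => y) := Measure.map_congr h
    _ = Measure.dirac y := by simp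

/-- A probability measure whose distance to a point of its support is almost everywhere
constant is the Dirac mass at that point. -/
lemma eq_dirac_of_ae_dist_eq {Y : Type*} [MetricSpace Y] [MeasurableSpace Y]
    {μ : Measure Y} [IsProbabilityMeasure μ] {y : Y} (hy : y ∈ msupport μ) {r : ℝ}
    (hr : 0 ≤ r) (h : ∀ᵐ x ∂μ, dist x y = r) : μ = Measure.dirac y := by
  obtain rfl | hr := hr.eq_or_lt
  · exact measure_eq_dirac_of_ae_eq (h.mono fun x hx => dist_eq_zero.1 hx)
  · refine absurd (measure_mono_null (fun x hx => ?_) (ae_iff.1 h))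
      (hy _ (Metric.mem_ball_self hr) Metric.isOpen_ball).ne'
    exact (Metric.mem_ball.1 hx).ne

/-- A square integrable function with second moment at most `c ^ 2` whose mean satisfies
`c ^ 2 ≤ c * 𝔼[f]` is almost everywhere equal to `c`. -/
lemma ae_eq_const_of_integral_sq_le {A : Type*} [MeasurableSpace A] {μ : Measure A}
    [IsProbabilityMeasure μ] {f : A → ℝ} (hf : MemLp f 2 μ) {c : ℝ}
    (h₂ : ∫ x, f x ^ 2 ∂μ ≤ c ^ 2) (h₁ : c ^ 2 ≤ c * ∫ x, f x ∂μ) :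
    ∀ᵐ x ∂μ, f x = c := by
  have hi := hf.integrable one_le_two
  have hint : Integrable (fun x => (f x - c) ^ 2) μ := (hf.sub (memLp_const c)).integrable_sq
  have hint' : Integrable (fun x => f x ^ 2 - 2 * c * f x) μ :=
    hf.integrable_sq.sub (hi.const_mul _)
  have heq : ∫ x, (f x - c) ^ 2 ∂μ = ∫ x, f x ^ 2 ∂μ - 2 * c * ∫ x, f x ∂μ + c ^ 2 := by
    calc ∫ x, (f x - c) ^ 2 ∂μ = ∫ x, (f x ^ 2 - 2 * c * f x + c ^ 2) ∂μ := by
          congr with x; ring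
      _ = _ := by
        rw [integral_add hint' (integrable_const _),
          integral_sub hf.integrable_sq (hi.const_mul _), integral_const_mul]
        simp
  have hzero : ∫ x, (f x - c) ^ 2 ∂μ = 0 :=
    le_antisymm (by linarith) (integral_nonneg fun x => sq_nonneg _)
  filter_upwards [(integral_eq_zero_iff_of_nonneg (fun x => sq_nonneg _) hint).1 hzero] with x hx
  exact sub_eq_zero.1 (pow_eq_zero_iff two_ne_zero |>.1 hx)

lemma sq_integral_le_integral_sq {A : Type*} [MeasurableSpace A] {μ : Measure A}
    [IsProbabilityMeasure μ] {f : A → ℝ} (hf : MemLp f 2 μ) :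
    (∫ x, f x ∂μ) ^ 2 ≤ ∫ x, f x ^ 2 ∂μ := by
  have := ProbabilityTheory.variance_nonneg f μ
  rw [ProbabilityTheory.variance_eq_sub hf] at this
  simpa using this

/-- **Statement 17.** In a geodesic Polish space `Y`, a geodesic segment of `W₂(Y)` going
from a measure `μ₀` which is not a Dirac mass to a Dirac mass `δ_y` with `y ∈ supp μ₀`
cannot be extended beyond time `1`. -/
theorem no_extension_beyond_dirac
    (Y : Type*) [MetricSpace Y] [MeasurableSpace Y] [BorelSpace Y]
    [CompleteSpace Y] [TopologicalSpace.SeparableSpace Y]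
    (hgeo : IsGeodesicSpace Y)
    (μ : ℝ → W2Space Y) (v : ℝ) (y : Y)
    (hnd : ¬ ∃ x : Y, (μ 0).1 = Measure.dirac x)
    (hy : y ∈ msupport ((μ 0).1))
    (h1 : (μ 1).1 = Measure.dirac y)
    (hseg : IsGeodesicOnWith Wdist μ (Set.Icc 0 1) v) :
    ∀ ε : ℝ, 0 < ε →
      ¬ ∃ g : ℝ → W2Space Y, IsGeodesicOnWith Wdist g (Set.Icc 0 (1 + ε)) v ∧
          ∀ t ∈ Set.Icc (0:ℝ) 1, g t = μ t := by
  rintro ε hε ⟨g, hg, hgμ⟩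
  have hs : (1 + ε) ∈ Icc (0 : ℝ) (1 + ε) := ⟨by linarith, le_rfl⟩
  have hz : (0 : ℝ) ∈ Icc (0 : ℝ) (1 + ε) := ⟨le_rfl, by linarith⟩
  have ho : (1 : ℝ) ∈ Icc (0 : ℝ) (1 + ε) := ⟨zero_le_one, by linarith⟩
  have hg1 : (g 1).1 = Measure.dirac y := by rw [hgμ 1 (by simp), h1]
  have d01 : Wdist (g 0) (g 1) = v := by simpa using hg 0 hz 1 ho
  have ds1 : Wdist (g (1 + ε)) (g 1) = v * ε := by simpa [abs_of_pos hε] using hg _ hs 1 ho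
  have d0s : Wdist (g 0) (g (1 + ε)) = v * (1 + ε) := by
    rw [hg 0 hz _ hs, zero_sub, abs_neg, abs_of_pos (by linarith)]
  have hv : 0 ≤ v := d01 ▸ Real.sqrt_nonneg _
  have hA := integral_dist_sq_le_Wdist_sq (g 0) (g 1) hg1
  have hB := integral_dist_sq_le_Wdist_sq (g (1 + ε)) (g 1) hg1
  have hC := Wdist_sq_le (g 0) (g (1 + ε)) y
  rw [d01] at hA
  rw [ds1] at hB
  rw [d0s] at hC
  have := (g 0).2.1
  have := (g (1 + ε)).2.1
  have hmean : ∫ x, dist x y ∂(g (1 + ε)).1 ≤ v * ε :=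
    le_of_sq_le_sq ((sq_integral_le_integral_sq ((g (1 + ε)).memLp_dist y)).trans hB)
      (by positivity)
  have hmean₀ : 0 ≤ ∫ x, dist x y ∂(g 0).1 := integral_nonneg fun x => dist_nonneg
  have hlow : v ^ 2 ≤ v * ∫ x, dist x y ∂(g 0).1 := by
    have := mul_le_mul_of_nonneg_left hmean hmean₀
    refine le_of_mul_le_mul_left ?_ hε
    nlinarith
  have hae := ae_eq_const_of_integral_sq_le ((g 0).memLp_dist y) hA hlow
  have hg0 : g 0 = μ 0 := hgμ 0 (by simp)
  exact hnd ⟨y, hg0 ▸ eq_dirac_of_ae_dist_eq (hg0 ▸ hy) hv hae⟩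

end
end

section
/- Let Y and Z be geodesic Polish metric spaces with Y geodesically complete and locally compact. Then any isometry from W₂(Y) onto W₂(Z) maps every Dirac mass of W₂(Y) to a Dirac mass of W₂(Z). -/
open MeasureTheory Filter Set Topology
open scoped NNReal ENNReal

noncomputable section


/-! ## Transport cost estimates -/

/-- In a geodesically complete geodesic space, segments issued from a point can be doubled. -/
lemma GeodesicallyComplete.exists_dist_eq_two_mul {Y : Type*} [MetricSpace Y]
    (hY : IsGeodesicSpace Y) (hYgc : GeodesicallyComplete Y) (x y : Y) :
    ∃ e : Y, dist x e = 2 * dist x y ∧ dist y e = dist x y := by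
  obtain ⟨γ, h0, h1, hγ⟩ := hY x y
  obtain ⟨g, hg, hgγ⟩ := hYgc γ 0 1 _ one_pos hγ
  have e0 : g 0 = x := (hgγ 0 (by simp)).trans h0
  have e1 : g 1 = y := (hgγ 1 (by simp)).trans h1
  refine ⟨g 2, ?_, ?_⟩
  · have := hg 0 (mem_univ _) 2 (mem_univ _)
    norm_num [e0] at this
    linarith
  · have := hg 1 (mem_univ _) 2 (mem_univ _)
    norm_num [e1] at this
    linarith

section TransportCost

variable {Y : Type*} [MetricSpace Y] [MeasurableSpace Y]

lemma Wdist_sq_s17 (μ ν : W2Space Y) : Wdist μ ν ^ 2 = (W2cost μ.1 ν.1).toReal :=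
  Real.sq_sqrt ENNReal.toReal_nonneg

lemma Wdist_comm (μ ν : W2Space Y) : Wdist μ ν = Wdist ν μ := by
  have key : ∀ μ ν : Measure Y, W2cost μ ν ≤ W2cost ν μ := fun μ ν =>
    le_iInf₂ fun π hπ => by
      refine iInf₂_le_of_le (π.map MeasurableEquiv.prodComm) ⟨?_, ?_⟩ (le_of_eq ?_)
      · rw [Measure.map_map measurable_fst MeasurableEquiv.prodComm.measurable]
        exact hπ.2
      · rw [Measure.map_map measurable_snd MeasurableEquiv.prodComm.measurable]
        exact hπ.1
      · rw [lintegral_map_equiv]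
        simp [MeasurableEquiv.prodComm, dist_comm]
  unfold Wdist
  rw [le_antisymm (key μ.1 ν.1) (key ν.1 μ.1)]

lemma W2Space.exists_of_memLp_dist {μ : Measure Y} [IsProbabilityMeasure μ] {x : Y}
    (h : MemLp (dist x) 2 μ) : ∃ ν : W2Space Y, ν.1 = μ := by
  refine ⟨⟨μ, inferInstance, x, ?_⟩, rfl⟩
  have hfin := h.integrable_sq.2
  rw [hasFiniteIntegral_iff_ofReal (ae_of_all _ fun y => sq_nonneg _)] at hfin
  simpa only [ENNReal.ofReal_pow dist_nonneg] using hfin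

/-- A probability measure for which every distance function is almost everywhere constant is
a Dirac mass. -/
lemma exists_eq_dirac_of_ae_dist_eq [SecondCountableTopology Y] (μ : Measure Y)
    [IsProbabilityMeasure μ] (h : ∀ z : Y, ∃ r : ℝ, ∀ᵐ y ∂μ, dist z y = r) :
    ∃ z : Y, μ = Measure.dirac z := by
  obtain ⟨z, hz⟩ := Measure.nonempty_support (IsProbabilityMeasure.ne_zero μ)
  obtain ⟨r, hr⟩ := h z
  have hr0 : r ≤ 0 := by
    by_contra! hpos
    refine ((Measure.mem_support_iff_forall z).1 hz _ (Metric.ball_mem_nhds z hpos)).ne' ?_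
    refine measure_mono_null (fun y hy => ?_) (ae_iff.1 hr)
    rw [Metric.mem_ball, dist_comm] at hy
    exact hy.ne
  have hae : ∀ᵐ y ∂μ, y = z := hr.mono fun y hy =>
    (dist_le_zero.1 (hy.trans_le hr0)).symm
  refine ⟨z, ?_⟩
  calc μ = μ.map id := Measure.map_id.symm
    _ = μ.map fun _ => z := Measure.map_congr hae
    _ = Measure.dirac z := by rw [Measure.map_const, measure_univ, one_smul]

variable [BorelSpace Y]

/-- Distance functions are square integrable for measures in the Wasserstein space. -/
lemma W2Space.memLp_dist_s17 (μ : W2Space Y) (x : Y) : MemLp (dist x) 2 μ.1 := by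
  obtain ⟨hμ, x₀, hx₀⟩ := μ.2
  have h₀ : MemLp (dist x₀) 2 μ.1 := by
    rw [memLp_two_iff_integrable_sq (by fun_prop)]
    refine ⟨by fun_prop, ?_⟩
    rw [hasFiniteIntegral_iff_ofReal (ae_of_all _ fun y => sq_nonneg _)]
    simpa only [ENNReal.ofReal_pow dist_nonneg] using hx₀
  refine (h₀.add (memLp_const (dist x x₀))).mono' (by fun_prop) (ae_of_all _ fun y => ?_)
  rw [Real.norm_of_nonneg dist_nonneg]
  simpa [add_comm] using dist_triangle x x₀ y

/-- The transport cost is at most the integral of the squared distance between two random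
variables with the prescribed laws. -/
lemma Wdist_sq_le_integral [SecondCountableTopology Y] {Ω : Type*} [MeasurableSpace Ω]
    {P : Measure Ω} {U V : Ω → Y} (hU : Measurable U) (hV : Measurable V) {μ ν : W2Space Y}
    (hμ : P.map U = μ.1) (hν : P.map V = ν.1) {g : Ω → ℝ} (hg : Integrable g P)
    (hle : ∀ ω, dist (U ω) (V ω) ^ 2 ≤ g ω) : Wdist μ ν ^ 2 ≤ ∫ ω, g ω ∂P := by
  have hg0 : ∀ ω, 0 ≤ g ω := fun ω => (sq_nonneg _).trans (hle ω)
  rw [Wdist_sq_s17]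
  refine ENNReal.toReal_le_of_le_ofReal (integral_nonneg hg0) ?_
  refine iInf₂_le_of_le (P.map fun ω => (U ω, V ω)) ⟨?_, ?_⟩ ?_
  · rw [Measure.map_map measurable_fst (hU.prodMk hV)]
    exact hμ
  · rw [Measure.map_map measurable_snd (hU.prodMk hV)]
    exact hν
  · rw [lintegral_map (by fun_prop) (hU.prodMk hV),
      ofReal_integral_eq_lintegral_ofReal hg (ae_of_all _ hg0)]
    refine lintegral_mono fun ω => ?_
    rw [← ENNReal.ofReal_pow dist_nonneg]
    exact ENNReal.ofReal_le_ofReal (hle ω)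

lemma Wdist_dirac_sq [SecondCountableTopology Y] {μ : W2Space Y} {x : Y}
    (hμ : μ.1 = Measure.dirac x) (ν : W2Space Y) :
    Wdist μ ν ^ 2 = ∫ y, dist x y ^ 2 ∂ν.1 := by
  have := ν.2.1
  refine le_antisymm (Wdist_sq_le_integral measurable_const measurable_id ?_ Measure.map_id
    (ν.memLp_dist_s17 x).integrable_sq fun y => le_rfl) ?_
  · rw [Measure.map_const, measure_univ, one_smul, hμ]
  · have hc : (∫⁻ y, ENNReal.ofReal (dist x y) ^ 2 ∂ν.1) = W2cost μ.1 ν.1 := by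
      have hπ : ∀ π : Measure (Y × Y), IsCoupling π μ.1 ν.1 →
          (∫⁻ p, ENNReal.ofReal (dist p.1 p.2) ^ 2 ∂π) =
            ∫⁻ y, ENNReal.ofReal (dist x y) ^ 2 ∂ν.1 := by
        rintro π ⟨h1, h2⟩
        have hx : ∀ᵐ p ∂π, p.1 = x := by
          refine ae_of_ae_map measurable_fst.aemeasurable (p := fun y => y = x) ?_
          rw [h1, hμ, ae_dirac_eq]
          rfl
        rw [← h2, lintegral_map (by fun_prop) measurable_snd]
        exact lintegral_congr_ae (hx.mono fun p hp => by simp only [hp])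
      refine le_antisymm (le_iInf₂ fun π h => (hπ π h).ge) ?_
      have hcpl : IsCoupling (ν.1.map fun y => (x, y)) μ.1 ν.1 := by
        constructor
        · rw [Measure.map_map measurable_fst (by fun_prop)]
          change ν.1.map (fun _ => x) = _
          rw [Measure.map_const, measure_univ, one_smul, hμ]
        · rw [Measure.map_map measurable_snd (by fun_prop)]
          exact Measure.map_id
      exact iInf₂_le_of_le _ hcpl (hπ _ hcpl).le
    rw [Wdist_sq_s17, ← hc, integral_eq_lintegral_of_nonneg_ae (ae_of_all _ fun y => sq_nonneg _)
      (by fun_prop)]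
    simp only [ENNReal.ofReal_pow dist_nonneg, le_refl]

/-- The estimate of the transport cost given by the independent coupling and the triangle
inequality through the point `z`. -/
lemma Wdist_sq_le_of_prod [SecondCountableTopology Y] (μ ν : W2Space Y) (z : Y) :
    Wdist μ ν ^ 2 ≤ ∫ y, dist z y ^ 2 ∂μ.1 + ∫ y, dist z y ^ 2 ∂ν.1
      + 2 * ((∫ y, dist z y ∂μ.1) * ∫ y, dist z y ∂ν.1) := by
  have := μ.2.1
  have := ν.2.1
  have i1 := (μ.memLp_dist_s17 z).integrable_sq.comp_fst ν.1
  have i2 := (ν.memLp_dist_s17 z).integrable_sq.comp_snd μ.1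
  have i3 := (((μ.memLp_dist_s17 z).integrable one_le_two).mul_prod
    ((ν.memLp_dist_s17 z).integrable one_le_two)).const_mul 2
  refine (Wdist_sq_le_integral measurable_fst measurable_snd Measure.fst_prod Measure.snd_prod
    ((i1.add i2).add i3) fun p => ?_).trans (le_of_eq ?_)
  · simp only [Pi.add_apply]
    have h := dist_triangle_left p.1 p.2 z
    nlinarith [dist_nonneg (x := p.1) (y := p.2)]
  · rw [integral_add' (i1.add i2) i3, integral_add' i1 i2, integral_const_mul, integral_prod_mul,
      integral_fun_fst (fun y => dist z y ^ 2), integral_fun_snd (fun y => dist z y ^ 2)]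
    simp

lemma sq_integral_dist_le (μ : W2Space Y) (z : Y) :
    (∫ y, dist z y ∂μ.1) ^ 2 ≤ ∫ y, dist z y ^ 2 ∂μ.1 := by
  have := μ.2.1
  have h := ProbabilityTheory.variance_nonneg (dist z) μ.1
  rw [ProbabilityTheory.variance_eq_sub (μ.memLp_dist_s17 z)] at h
  simpa using h

lemma ae_dist_eq_of_integral_sq_le (μ : W2Space Y) (z : Y)
    (h : ∫ y, dist z y ^ 2 ∂μ.1 ≤ (∫ y, dist z y ∂μ.1) ^ 2) :
    ∀ᵐ y ∂μ.1, dist z y = ∫ y, dist z y ∂μ.1 := by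
  have := μ.2.1
  have hL := μ.memLp_dist_s17 z
  have h0 : ProbabilityTheory.variance (dist z) μ.1 = 0 := by
    refine le_antisymm ?_ (ProbabilityTheory.variance_nonneg _ _)
    rw [ProbabilityTheory.variance_eq_sub hL]
    simpa using h
  rw [ProbabilityTheory.variance_eq_integral hL.aemeasurable] at h0
  have hae := (integral_eq_zero_iff_of_nonneg (fun y => sq_nonneg _)
    (hL.sub (memLp_const (∫ y, dist z y ∂μ.1))).integrable_sq).1 h0
  filter_upwards [hae] with y hy
  exact sub_eq_zero.1 (pow_eq_zero_iff two_ne_zero |>.1 hy)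

/-- The doubling of segments issued from a point admits approximate measurable selections. -/
lemma GeodesicallyComplete.exists_measurable_doubling [TopologicalSpace.SeparableSpace Y]
    (hY : IsGeodesicSpace Y) (hYgc : GeodesicallyComplete Y) (x : Y) {ε : ℝ} (hε : 0 < ε) :
    ∃ f : Y → Y, Measurable f ∧ (∀ y, |dist x (f y) - 2 * dist x y| ≤ 2 * ε) ∧
      ∀ y, dist y (f y) ≤ dist x y + 2 * ε := by
  classical
  have : Nonempty Y := ⟨x⟩
  choose e he1 he2 using hYgc.exists_dist_eq_two_mul hY x
  let D := TopologicalSpace.denseSeq Y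
  have hD : ∀ y, ∃ n, dist y (D n) < ε := fun y =>
    (TopologicalSpace.denseRange_denseSeq Y).exists_dist_lt y hε
  have hN : Measurable fun y => Nat.find (hD y) :=
    measurable_find hD fun n => measurableSet_lt (by fun_prop) measurable_const
  have key : ∀ y, dist y (D (Nat.find (hD y))) < ε := fun y => Nat.find_spec (hD y)
  refine ⟨fun y => e (D (Nat.find (hD y))),
    (measurable_from_top (f := fun n => e (D n))).comp hN, fun y => ?_, fun y => ?_⟩
  · rw [he1, abs_le]
    constructor <;>
      linarith [key y, dist_triangle x y (D (Nat.find (hD y))),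
        dist_triangle_right x y (D (Nat.find (hD y)))]
  · linarith [key y, dist_triangle x y (D (Nat.find (hD y))), he2 (D (Nat.find (hD y))),
      dist_triangle y (D (Nat.find (hD y))) (e (D (Nat.find (hD y))))]

/-- Wasserstein segments issued from a Dirac mass can approximately be doubled. -/
lemma exists_approx_doubling [SecondCountableTopology Y] (hY : IsGeodesicSpace Y)
    (hYgc : GeodesicallyComplete Y) {μ : W2Space Y} {x : Y} (hμ : μ.1 = Measure.dirac x)
    (σ : W2Space Y) {ε : ℝ} (hε : 0 < ε) :
    ∃ σ' : W2Space Y,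
      4 * Wdist μ σ ^ 2 - 8 * ε * ∫ y, dist x y ∂σ.1 ≤ Wdist μ σ' ^ 2 ∧
      Wdist σ σ' ^ 2 ≤ Wdist μ σ ^ 2 + 4 * ε * ∫ y, dist x y ∂σ.1 + 4 * ε ^ 2 := by
  have := σ.2.1
  obtain ⟨f, hf, hf1, hf2⟩ := hYgc.exists_measurable_doubling hY x hε
  have hL := σ.memLp_dist_s17 x
  have i1 := hL.integrable one_le_two
  have i2 := hL.integrable_sq
  have hLf : MemLp (fun y => dist x (f y)) 2 σ.1 := by
    refine ((hL.const_mul 2).add (memLp_const (2 * ε))).mono' (by fun_prop)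
      (ae_of_all _ fun y => ?_)
    rw [Real.norm_of_nonneg dist_nonneg]
    simp only [Pi.add_apply]
    linarith [(abs_le.1 (hf1 y)).2]
  have : IsProbabilityMeasure (σ.1.map f) := Measure.isProbabilityMeasure_map hf.aemeasurable
  obtain ⟨σ', hσ'⟩ := W2Space.exists_of_memLp_dist (μ := σ.1.map f) (x := x)
    ((memLp_map_measure_iff (by fun_prop) hf.aemeasurable).2 hLf)
  refine ⟨σ', ?_, ?_⟩
  · rw [Wdist_dirac_sq hμ, Wdist_dirac_sq hμ, hσ', integral_map hf.aemeasurable (by fun_prop),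
      ← integral_const_mul, ← integral_const_mul,
      ← integral_sub (i2.const_mul 4) (i1.const_mul (8 * ε))]
    refine integral_mono ((i2.const_mul 4).sub (i1.const_mul (8 * ε))) hLf.integrable_sq
      fun y => ?_
    have h := (abs_le.1 (hf1 y)).1
    have h0 : 0 ≤ dist x y := dist_nonneg
    change 4 * dist x y ^ 2 - 8 * ε * dist x y ≤ dist x (f y) ^ 2
    rcases le_total (dist x y) ε with hle | hle
    · nlinarith [sq_nonneg (dist x (f y)), mul_nonneg h0 (sub_nonneg.2 hle), mul_nonneg h0 hε.le]
    · have : (2 * dist x y - 2 * ε) ^ 2 ≤ dist x (f y) ^ 2 :=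
        pow_le_pow_left₀ (by linarith) (by linarith) 2
      nlinarith [sq_nonneg ε]
  · refine (Wdist_sq_le_integral measurable_id hf Measure.map_id hσ'.symm
      ((i2.add (i1.const_mul (4 * ε))).add (integrable_const (4 * ε ^ 2))) fun y => ?_).trans
      (le_of_eq ?_)
    · have : dist y (f y) ^ 2 ≤ (dist x y + 2 * ε) ^ 2 := pow_le_pow_left₀ dist_nonneg (hf2 y) 2
      simp only [Pi.add_apply, id]
      linarith
    · rw [integral_add' (i2.add (i1.const_mul (4 * ε))) (integrable_const _),
        integral_add' i2 (i1.const_mul (4 * ε)), integral_const_mul, Wdist_dirac_sq hμ]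
      simp

end TransportCost

/-- **Statement 18.** Any isometry from `W₂(Y)` onto `W₂(Z)`, with `Y` a geodesically
complete locally compact geodesic Polish space and `Z` a geodesic Polish space, maps Dirac
masses to Dirac masses. -/
theorem isometry_maps_dirac_to_dirac
    (Y Z : Type*)
    [MetricSpace Y] [MeasurableSpace Y] [BorelSpace Y]
    [CompleteSpace Y] [TopologicalSpace.SeparableSpace Y] [LocallyCompactSpace Y]
    [MetricSpace Z] [MeasurableSpace Z] [BorelSpace Z]
    [CompleteSpace Z] [TopologicalSpace.SeparableSpace Z]
    (hY : IsGeodesicSpace Y) (hZ : IsGeodesicSpace Z) (hYgc : GeodesicallyComplete Y)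
    (F : W2Space Y ≃ W2Space Z) (hF : ∀ μ ν : W2Space Y, Wdist (F μ) (F ν) = Wdist μ ν) :
    ∀ (μ : W2Space Y) (x : Y), μ.1 = Measure.dirac x →
      ∃ z : Z, (F μ).1 = Measure.dirac z := by
  intro μ x hμ
  have := UniformSpace.secondCountable_of_separable Y
  have := UniformSpace.secondCountable_of_separable Z
  have := (F μ).2.1
  refine exists_eq_dirac_of_ae_dist_eq _ fun z =>
    ⟨_, ae_dist_eq_of_integral_sq_le (F μ) z ?_⟩
  obtain ⟨ζ, hζ⟩ := W2Space.exists_of_memLp_dist (μ := Measure.dirac z) (x := z)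
    ((memLp_const (dist z z)).ae_eq (by rw [EventuallyEq, ae_dirac_eq]; rfl))
  set σ := F.symm ζ
  have hFσ : F σ = ζ := F.apply_symm_apply ζ
  set m := ∫ y, dist z y ∂(F μ).1
  set a := ∫ y, dist x y ∂σ.1
  have hm : 0 ≤ m := integral_nonneg fun y => dist_nonneg
  have hc : Wdist μ σ ^ 2 = ∫ y, dist z y ^ 2 ∂(F μ).1 := by
    rw [← hF, hFσ, Wdist_comm, Wdist_dirac_sq hζ]
  rw [← hc]
  set w := Wdist μ σ
  have hw : 0 ≤ w := Real.sqrt_nonneg _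
  have hbound : ∀ ε : ℝ, 0 < ε → 2 * w ^ 2 - 12 * ε * a - 4 * ε ^ 2 ≤
      2 * (m * Real.sqrt (w ^ 2 + 4 * ε * a + 4 * ε ^ 2)) := by
    intro ε hε
    obtain ⟨σ', h1, h2⟩ := exists_approx_doubling hY hYgc hμ σ hε
    have h3 := Wdist_sq_le_of_prod (F μ) (F σ') z
    have h4 := sq_integral_dist_le (F σ') z
    have h5 : Wdist σ σ' ^ 2 = ∫ y, dist z y ^ 2 ∂(F σ').1 := by
      rw [← hF, hFσ, Wdist_dirac_sq hζ]
    rw [← h5] at h3 h4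
    rw [hF, ← hc] at h3
    have h6 := mul_le_mul_of_nonneg_left (Real.le_sqrt_of_sq_le (h4.trans h2)) hm
    linarith
  have hlim : 2 * w ^ 2 ≤ 2 * (m * w) := by
    have hL : Tendsto (fun ε : ℝ => 2 * w ^ 2 - 12 * ε * a - 4 * ε ^ 2) (𝓝[>] 0)
        (𝓝 (2 * w ^ 2)) := by
      refine tendsto_nhdsWithin_of_tendsto_nhds ?_
      convert (Continuous.tendsto (by fun_prop :
        Continuous fun ε : ℝ => 2 * w ^ 2 - 12 * ε * a - 4 * ε ^ 2) 0) using 2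
      ring
    have hR : Tendsto (fun ε : ℝ => 2 * (m * Real.sqrt (w ^ 2 + 4 * ε * a + 4 * ε ^ 2))) (𝓝[>] 0)
        (𝓝 (2 * (m * w))) := by
      refine tendsto_nhdsWithin_of_tendsto_nhds ?_
      convert (Continuous.tendsto (by fun_prop :
        Continuous fun ε : ℝ => 2 * (m * Real.sqrt (w ^ 2 + 4 * ε * a + 4 * ε ^ 2))) 0) using 2
      simp [Real.sqrt_sq hw]
    exact le_of_tendsto_of_tendsto hL hR
      (eventually_nhdsWithin_of_forall fun ε hε => hbound ε hε)
  rcases hw.eq_or_lt with h0 | hpos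
  · rw [← h0]
    nlinarith
  · exact pow_le_pow_left₀ hw (le_of_mul_le_mul_right (by linarith) hpos) 2

end
end

section
/- Inversion formula for the combinatorial perpendicular Radon transform on a tree: let X be a locally finite tree without leaves and with no vertex of valency 2, with vertex set V, and let h: V → ℝ be summable. Then for every vertex x of valency k(x), h(x) = (1/(k(x)−1)) · Σ_{ef ∋ x} Rh(x,ef) − ((k(x)−2)/2) · Σ_{y∈V} h(y), where the first sum runs over unordered pairs {e,f} of distinct edges incident to x. In particular, if h, l: V → ℝ are summable with Σ h = Σ l and Rh = Rl on all flags, then h = l. -/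
open MeasureTheory Filter Set Topology
open scoped NNReal ENNReal

noncomputable section


/-- A neighbor of `x` lies in the component of `G - x` of every vertex other than `x`. -/
lemma exists_neighbor_sameComp {V : Type*} {G : SimpleGraph V} (hG : G.Connected) {x y : V}
    (hy : y ≠ x) : ∃ e, G.Adj x e ∧ sameComp G x y e := by
  obtain ⟨p, hp⟩ := (hG.preconnected x y).exists_isPath
  cases p with
  | nil => exact absurd rfl hy
  | @cons _ e _ hadj q =>
    have hx : x ∉ q.support := ((SimpleGraph.Walk.cons_isPath_iff _ _).1 hp).2
    have hq : ∀ w ∈ q.support, w ∈ {w : V | w ≠ x} := fun w hw hwx => hx (hwx ▸ hw)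
    exact ⟨e, hadj, hy, hadj.ne', (q.induce _ hq).reachable.symm⟩

/-- In an acyclic graph, distinct neighbors of `x` lie in distinct components of `G - x`. -/
lemma eq_of_adj_of_sameComp {V : Type*} {G : SimpleGraph V} (hG : G.IsAcyclic) {x y e f : V}
    (he : G.Adj x e) (hf : G.Adj x f) (hye : sameComp G x y e) (hyf : sameComp G x y f) :
    e = f := by
  obtain ⟨hy, hex, hre⟩ := hye
  obtain ⟨_, hfx, hrf⟩ := hyf
  obtain ⟨q, hq⟩ := (hre.symm.trans hrf).exists_isPath
  obtain ⟨r, hr, hx⟩ : ∃ r : G.Walk e f, r.IsPath ∧ x ∉ r.support := by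
    let φ := SimpleGraph.Embedding.induce (G := G) {w : V | w ≠ x}
    have hx : x ∉ (q.map φ.toHom).support := by
      rw [SimpleGraph.Walk.support_map, List.mem_map]
      rintro ⟨w, -, hw⟩
      exact w.2 hw
    exact ⟨q.map φ.toHom, hq.map φ.injective, hx⟩
  have huniq := (hG.subsingleton_path x f).elim
    ⟨_, hr.cons hx (h := he)⟩ (SimpleGraph.Path.singleton hf)
  simpa using congrArg (fun p : G.Path x f => p.1.snd) huniq

/-- For a vertex `y` other than `x`, the perpendiculars at `x` containing `y` are those of the
pairs avoiding one fixed neighbor of `x`. -/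
lemma exists_neighbor_mem_perpSet_iff {V : Type*} {G : SimpleGraph V} (hG : G.IsTree) {x y : V}
    (hy : y ≠ x) : ∃ e, G.Adj x e ∧
      ∀ p : Finset V, (∀ f ∈ p, G.Adj x f) → (y ∈ perpSet G x p ↔ e ∉ p) := by
  obtain ⟨e, he, hye⟩ := exists_neighbor_sameComp hG.connected hy
  refine ⟨e, he, fun p hp => ?_⟩
  simp only [perpSet, mem_union, mem_singleton_iff, hy, false_or, mem_ofPred_eq]
  exact ⟨fun h hep => h e hep hye,
    fun h f hf hyf => h (eq_of_adj_of_sameComp hG.isAcyclic he (hp f hf) hye hyf ▸ hf)⟩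

open Classical in
/-- The number of perpendiculars at `x` containing `y`, summed against `h`. -/
lemma sum_indicator_perpSet {V : Type*} {G : SimpleGraph V} [∀ v : V, Fintype (G.neighborSet v)]
    (hG : G.IsTree) (h : V → ℝ) {x : V} (hx : 1 ≤ G.degree x) (y : V) :
    ∑ p ∈ (G.neighborFinset x).powersetCard 2, (perpSet G x p).indicator h y =
      ((G.degree x : ℝ) - 1) * ((G.degree x : ℝ) - 2) / 2 * h y +
        if y = x then ((G.degree x : ℝ) - 1) * h x else 0 := by
  by_cases hy : y = x
  · subst hy
    have hmem : ∀ p, y ∈ perpSet G y p := fun p => Or.inl rfl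
    simp only [indicator_of_mem (hmem _), Finset.sum_const, Finset.card_powersetCard,
      SimpleGraph.card_neighborFinset_eq_degree, nsmul_eq_mul, Nat.cast_choose_two, if_true]
    ring
  · obtain ⟨e, he, hmem⟩ := exists_neighbor_mem_perpSet_iff hG hy
    have hfilter : {p ∈ (G.neighborFinset x).powersetCard 2 | y ∈ perpSet G x p} =
        ((G.neighborFinset x).erase e).powersetCard 2 := by
      ext p
      simp only [Finset.mem_filter, Finset.mem_powersetCard, Finset.subset_erase]
      constructor
      · rintro ⟨⟨hp, hc⟩, hyp⟩
        exact ⟨⟨hp, (hmem p fun f hf => by simpa using hp hf).1 hyp⟩, hc⟩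
      · rintro ⟨⟨hp, hep⟩, hc⟩
        exact ⟨⟨hp, hc⟩, (hmem p fun f hf => by simpa using hp hf).2 hep⟩
    simp only [indicator_apply, if_neg hy]
    rw [← Finset.sum_filter, hfilter, Finset.sum_const, Finset.card_powersetCard,
      Finset.card_erase_of_mem (by simpa using he), SimpleGraph.card_neighborFinset_eq_degree,
      nsmul_eq_mul, Nat.cast_choose_two, Nat.cast_sub hx]
    push_cast
    ring

/-- The sum of the Radon transform over all flags at a vertex. -/
lemma sum_perpRadon {V : Type*} {G : SimpleGraph V} [∀ v : V, Fintype (G.neighborSet v)]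
    (hG : G.IsTree) {h : V → ℝ} (hh : Summable h) {x : V} (hx : 1 ≤ G.degree x) :
    ∑ p ∈ (G.neighborFinset x).powersetCard 2, perpRadon G h x p =
      ((G.degree x : ℝ) - 1) * ((G.degree x : ℝ) - 2) / 2 * ∑' y, h y +
        ((G.degree x : ℝ) - 1) * h x := by
  classical
  have hsum : HasSum (fun y => ∑ p ∈ (G.neighborFinset x).powersetCard 2,
      (perpSet G x p).indicator h y)
      (∑ p ∈ (G.neighborFinset x).powersetCard 2, perpRadon G h x p) := by
    refine hasSum_sum fun p _ => ?_
    rw [perpRadon, tsum_subtype]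
    exact (hh.indicator _).hasSum
  simp only [sum_indicator_perpSet hG h hx] at hsum
  exact hsum.unique ((hh.hasSum.mul_left _).add (hasSum_ite_eq x _))

/-- The inversion formula at a single vertex of valency at least `2`. -/
lemma radon_inversion_at {V : Type*} {G : SimpleGraph V} [∀ v : V, Fintype (G.neighborSet v)]
    (hG : G.IsTree) {h : V → ℝ} (hh : Summable h) {x : V} (hx : 2 ≤ G.degree x) :
    h x = (1 / ((G.degree x : ℝ) - 1)) *
        (∑ p ∈ (G.neighborFinset x).powersetCard 2, perpRadon G h x p) -
      (((G.degree x : ℝ) - 2) / 2) * ∑' y : V, h y := by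
  rw [sum_perpRadon hG hh (by omega)]
  have hk : (G.degree x : ℝ) - 1 ≠ 0 := by
    have : (2 : ℝ) ≤ G.degree x := by exact_mod_cast hx
    linarith
  field_simp
  ring

/-- **Statement 19.** Inversion formula for the combinatorial perpendicular Radon transform
on a locally finite tree all of whose vertices have valency at least 3; in particular two
summable functions with the same total sum and the same Radon transform on all flags are
equal. -/
theorem radon_inversion_on_tree
    (V : Type*) [DecidableEq V] (G : SimpleGraph V) [∀ v : V, Fintype (G.neighborSet v)]
    (htree : G.IsTree) (hdeg : ∀ v : V, 3 ≤ G.degree v)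
    (h l : V → ℝ) (hh : Summable h) (hl : Summable l) :
    (∀ x : V, h x = (1 / ((G.degree x : ℝ) - 1)) *
        (∑ p ∈ (G.neighborFinset x).powersetCard 2, perpRadon G h x p) -
      (((G.degree x : ℝ) - 2) / 2) * ∑' y : V, h y) ∧
    ((∑' y : V, h y = ∑' y : V, l y) →
      (∀ (x : V) (p : Finset V), p ⊆ G.neighborFinset x → p.card = 2 →
        perpRadon G h x p = perpRadon G l x p) → h = l) := by
  have inv : ∀ f : V → ℝ, Summable f → ∀ x : V, _ :=
    fun f hf x => radon_inversion_at htree hf (le_trans (by norm_num) (hdeg x))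
  refine ⟨inv h hh, fun htot hR => funext fun x => ?_⟩
  rw [inv h hh x, inv l hl x, htot]
  congr 2
  refine Finset.sum_congr rfl fun p hp => ?_
  rw [Finset.mem_powersetCard] at hp
  exact hR x p hp.1 hp.2

end
end
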